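/- In ℂ[x,y], let i be the imaginary unit and s = √3 (the positive real square root of 3), and define f2 = -(667/676)y^2 - (135/676)i y^2 s - (53/26)xy + (15/26)i xy s + y - x^2 + x, g2 = y^2, and h2 = (409455/228488)x^2 + (915381/742586)xy + (2175255/1485172)i xy s + (16605/28561)i s - 25029/57122 + (20915415/38614472)i y^2 s - (291195/228488)i x s + (18225/228488)i x^2 s - (262035/228488)i y s - (373005/228488)x + (282123/228488)y - (15287373/19307236)y^2. Let g = f2^3 + g2 * h2. Then g is irreducible in ℂ[x,y], and there do not exist polynomials p, q ∈ ℂ[x,y] with total degree of p at most 2 and total degree of q at most 3 such that g = p^3 + q^2. -/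

import Mathlib

open MvPolynomial

noncomputable section

def x : MvPolynomial (Fin 2) ℂ := X 0
def y : MvPolynomial (Fin 2) ℂ := X 1
def c (q : ℚ) : MvPolynomial (Fin 2) ℂ := C (q : ℂ)

/-- The imaginary unit, as a constant polynomial. -/
def i : MvPolynomial (Fin 2) ℂ := C Complex.I
/-- `s = √3`, as a constant polynomial. -/
def s : MvPolynomial (Fin 2) ℂ := C ((Real.sqrt 3 : ℝ) : ℂ)

def f2 : MvPolynomial (Fin 2) ℂ :=
  - c (667/676) * y ^ 2 - c (135/676) * i * y ^ 2 * s - c (53/26) * x * y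
    + c (15/26) * i * x * y * s + y - x ^ 2 + x

def g2 : MvPolynomial (Fin 2) ℂ := y ^ 2

def h2 : MvPolynomial (Fin 2) ℂ :=
  c (409455/228488) * x ^ 2 + c (915381/742586) * x * y
    + c (2175255/1485172) * i * x * y * s + c (16605/28561) * i * s - c (25029/57122)
    + c (20915415/38614472) * i * y ^ 2 * s - c (291195/228488) * i * x * s
    + c (18225/228488) * i * x ^ 2 * s - c (262035/228488) * i * y * s
    - c (373005/228488) * x + c (282123/228488) * y - c (15287373/19307236) * y ^ 2

/-- The sextic of semi-torus type with configuration `[2E_6 + A_5]`. -/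
def g : MvPolynomial (Fin 2) ℂ := f2 ^ 3 + g2 * h2

/-! ### Part 1: linear algebra modulo 31 -/

section LinAlg

/-- `676 * f2` -/
def kF {R : Type} [CommRing R] (w u v : R) : R :=
  (-667 - 135 * w) * v ^ 2 + (-1378 + 390 * w) * u * v + 676 * v - 676 * u ^ 2 + 676 * u
def kFx {R : Type} [CommRing R] (w u v : R) : R :=
  (-1378 + 390 * w) * v - 1352 * u + 676
def kFy {R : Type} [CommRing R] (w u v : R) : R :=
  2 * (-667 - 135 * w) * v + (-1378 + 390 * w) * u + 676
/-- `38614472 * h2` -/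
def kH {R : Type} [CommRing R] (w u v : R) : R :=
  (69197895 + 3080025 * w) * u ^ 2 + (47599812 + 56556630 * w) * u * v
    + (-16919604 + 22449960 * w) + (-30574746 + 20915415 * w) * v ^ 2
    + (-63037845 - 49211955 * w) * u + (47678787 - 44283915 * w) * v
def kHx {R : Type} [CommRing R] (w u v : R) : R :=
  2 * (69197895 + 3080025 * w) * u + (47599812 + 56556630 * w) * v
    + (-63037845 - 49211955 * w)
def kHy {R : Type} [CommRing R] (w u v : R) : R :=
  (47599812 + 56556630 * w) * u + 2 * (-30574746 + 20915415 * w) * v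
    + (47678787 - 44283915 * w)
def kG {R : Type} [CommRing R] (w u v : R) : R := kF w u v ^ 3 + 8 * v ^ 2 * kH w u v
def kGx {R : Type} [CommRing R] (w u v : R) : R :=
  3 * kF w u v ^ 2 * kFx w u v + 8 * v ^ 2 * kHx w u v
def kGy {R : Type} [CommRing R] (w u v : R) : R :=
  3 * kF w u v ^ 2 * kFy w u v + 16 * v * kH w u v + 8 * v ^ 2 * kHy w u v
def kGz {R : Type} [CommRing R] (w u v : R) : R :=
  6 * kG w u v - u * kGx w u v - v * kGy w u v
def kk {R : Type} [CommRing R] (t : ℕ) (w u v : R) : R :=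
  match t with
  | 0 => kGx w u v
  | 1 => kGy w u v
  | _ => kGz w u v

lemma kk_map {R S : Type} [CommRing R] [CommRing S] (φ : R →+* S) (t : ℕ) (w u v : R) :
    φ (kk t w u v) = kk t (φ w) (φ u) (φ v) := by
  have ho : ∀ (n : ℕ) [n.AtLeastTwo], φ (OfNat.ofNat n) = OfNat.ofNat n := fun n _ => map_ofNat φ n
  unfold kk
  split <;> simp only [map_add, map_sub, map_mul, map_pow, map_neg, ho, kGx, kGy, kGz, kG, kF, kFx, kFy, kH, kHx, kHy]

def uT (r : ℕ) : ℕ := 259947384300228809072156122811474176 / 16 ^ r % 16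
def vT (r : ℕ) : ℕ := 360357661572086650980376940952879393 / 16 ^ r % 16
def gT (t r : ℕ) : ℕ :=
  1719295296854182363861231048350824000206438094284275172208382029261730253179710837030993890912223317661174938578500613664444640191654368 / 32 ^ (30 * t + r) % 32
def nT (j r : ℕ) : ℕ :=
  7119893968607528051358146187713752536342286029595400142113856686178732060101844163690457895267500817108648393300127619787886132159592771822942440377166445375197443922994915845893190223649922660137593336462426446831984416248376493362876129408695861669583269251873703861771509486312027339127353384405023655816968797689915999265065819676830087051625158730565827821043821503837544312943480985961946504345724449912455511703191717205741567673861997724372151842463646844833554074659723533423418990316270840698626398109427342966992539583568544133373160753173964244122036500909280852658061823049858923032387649631784023572032184707549772206748472218483878741239465363377107974483187042001031313534084937930365527866621184158790354024666603441520492154071901009985453906664550501223567873421400734000674113210694866845187835396014144708661981810147733959876755725665407590746007411139484714326011694582483479028311268564154130686417646475321585288832862395485971376622378479637716176998801015024332881011014758988622504575266082856156338593481081374670216552792058681082161459256986402608984126809928033048246129550825788089750879085725143288788910262461887005245665001865041214784481802243139644613885764535747451832836372166775755576979003954305800658524795747658696950459420701038458232735265581274183412297389699630389350906149528815916093352981511338516295333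 / 32 ^ (30 * j + r) % 32
def e1 (m : ℕ) : ℕ := 955648 / 4 ^ m % 4
def e2 (m : ℕ) : ℕ := 74980 / 4 ^ m % 4

def kM {R : Type} [CommRing R] (w : R) : Matrix (Fin 30) (Fin 30) R := fun r j =>
  (uT r : R) ^ e1 (j % 10) * (vT r : R) ^ e2 (j % 10) * kk (j / 10) w (uT r) (vT r)

lemma kM_map {R S : Type} [CommRing R] [CommRing S] (φ : R →+* S) (w : R) :
    (kM w).map φ = kM (φ w) := by
  ext r j
  simp [kM, kk_map]

lemma gT_spec : ∀ (t : Fin 3) (r : Fin 30),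
    (kk (R := ℤ) t.val 11 (uT r) (vT r) - (gT t.val r : ℤ)) % 31 = 0 := by
  decide +kernel

lemma nT_spec : ∀ (j l : Fin 30),
    ((List.finRange 30).map (fun r : Fin 30 =>
      nT j r * (uT r ^ e1 (l % 10) * vT r ^ e2 (l % 10) * gT (l / 10) r))).sum % 31
      = if j = l then 1 else 0 := by
  decide +kernel

attribute [irreducible] uT vT gT nT

def kN {R : Type} [CommRing R] : Matrix (Fin 30) (Fin 30) R := fun j r => (nT j r : R)

lemma kN_mul : (kN * kM (11 : ZMod 31) : Matrix (Fin 30) (Fin 30) (ZMod 31)) = 1 := by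
  ext j l
  have h := nT_spec j l
  have hk : ∀ r : Fin 30, kk (l.val / 10) (11 : ZMod 31) (uT r) (vT r)
      = (gT (l.val / 10) r : ZMod 31) := by
    intro r
    have h1 := gT_spec ⟨l.val / 10, by omega⟩ r
    have h2 := (ZMod.intCast_zmod_eq_zero_iff_dvd _ 31).2 (Int.dvd_of_emod_eq_zero h1)
    have h3 := kk_map (Int.castRingHom (ZMod 31)) (l.val / 10) 11 (uT r) (vT r)
    simp only [Int.cast_sub, Int.cast_natCast] at h2
    simp only [eq_intCast, Int.cast_natCast] at h3
    rw [sub_eq_zero] at h2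
    rw [← h2, h3]
    norm_num
  rw [Matrix.mul_apply, Matrix.one_apply, Fin.sum_univ_def]
  have h4 : ((List.finRange 30).map (fun r : Fin 30 => (kN j r : ZMod 31) * kM 11 r l)).sum
      = ((((List.finRange 30).map (fun r : Fin 30 =>
      nT j r * (uT r ^ e1 (l % 10) * vT r ^ e2 (l % 10) * gT (l / 10) r))).sum : ℕ) : ZMod 31) := by
    rw [Nat.cast_list_sum, List.map_map]
    refine congrArg List.sum (List.map_congr_left ?_)
    intro r _
    simp only [kN, kM, hk, Function.comp, Nat.cast_mul, Nat.cast_pow]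
  rw [h4, ← ZMod.natCast_mod, h]
  split <;> simp

def kW : ℂ := Complex.I * ((Real.sqrt 3 : ℝ) : ℂ)

lemma kW_sq : kW * kW = ((-3 : ℤ) : ℂ) := by
  have h : (((Real.sqrt 3 : ℝ) : ℂ)) * ((Real.sqrt 3 : ℝ) : ℂ) = 3 := by
    rw [← Complex.ofReal_mul, Real.mul_self_sqrt (by norm_num)]; norm_num
  unfold kW
  push_cast
  linear_combination (((Real.sqrt 3 : ℝ) : ℂ)) ^ 2 * Complex.I_mul_I - h

lemma kM_inj (z : Fin 30 → ℂ) (hz : (kM kW).mulVec z = 0) : z = 0 := by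
  let φ : ℤ√(-3) →+* ℂ := Zsqrtd.lift ⟨kW, kW_sq⟩
  let ψ : ℤ√(-3) →+* ZMod 31 := Zsqrtd.lift ⟨11, by decide⟩
  have hφi : Function.Injective φ := Zsqrtd.lift_injective _ (by
    intro n hn; nlinarith [mul_self_nonneg n])
  have hφ : φ Zsqrtd.sqrtd = kW := by simp [φ, Zsqrtd.lift]
  have hψ : ψ Zsqrtd.sqrtd = 11 := by simp [ψ, Zsqrtd.lift]
  let P : Matrix (Fin 30) (Fin 30) (ℤ√(-3)) := kN * kM Zsqrtd.sqrtd
  have hP : P.map ψ = 1 := by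
    rw [← kN_mul, ← hψ, ← kM_map]
    simp only [P, Matrix.map_mul]
    congr 1
    ext a b; simp [kN]
  have hd : P.det ≠ 0 := by
    intro h0
    have h1 : ψ P.det = (P.map ψ).det := by
      rw [RingHom.map_det]; rfl
    rw [h0, hP] at h1
    rw [map_zero, Matrix.det_one] at h1
    exact absurd h1 (by decide)
  have hd2 : (P.map φ).det ≠ 0 := by
    have h1 : φ P.det = (P.map φ).det := by
      rw [RingHom.map_det]; rfl
    rw [← h1]
    intro h2
    exact hd (hφi (by rw [h2, map_zero]))
  apply Matrix.eq_zero_of_mulVec_eq_zero hd2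
  simp only [P, Matrix.map_mul]
  rw [kM_map, hφ, ← Matrix.mulVec_mulVec, hz, Matrix.mulVec_zero]

end LinAlg

/-! ### Part 2: degree bounds -/

def mn (m n : ℕ) : Fin 2 →₀ ℕ := Finsupp.single 0 m + Finsupp.single 1 n

lemma degree_two (d : Fin 2 →₀ ℕ) : (d.sum fun _ e => e) = d 0 + d 1 := by
  rw [Finsupp.sum_fintype _ _ (by simp)]; simp

lemma td_pderiv (k : Fin 2) (n : ℕ) (p : MvPolynomial (Fin 2) ℂ) (hp : p.totalDegree ≤ n + 1) :
    (pderiv k p).totalDegree ≤ n := by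
  conv_lhs => rw [p.as_sum]
  rw [map_sum]
  apply totalDegree_finsetSum_le
  intro d hd
  rw [pderiv_monomial]
  by_cases h0 : d k = 0
  · simp [h0]
  refine (totalDegree_monomial_le _ _).trans ?_
  have h1 := (le_totalDegree hd).trans hp
  rw [degree_two] at h1
  have h2 := degree_two (d - Finsupp.single k 1)
  simp only [Finsupp.coe_tsub, Pi.sub_apply] at h2
  have h3 : ((d - Finsupp.single k 1).sum fun _ e => e) ≤ n := by
    rw [h2]
    fin_cases k <;> simp at h0 ⊢ <;> omega
  exact h3

def eul (n : ℕ) (p : MvPolynomial (Fin 2) ℂ) : MvPolynomial (Fin 2) ℂ :=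
  C ((n : ℂ) + 1) * p - X 0 * pderiv 0 p - X 1 * pderiv 1 p

lemma td_eul (n : ℕ) (p : MvPolynomial (Fin 2) ℂ) (hp : p.totalDegree ≤ n + 1) :
    (eul n p).totalDegree ≤ n := by
  have h : eul n p = ∑ d ∈ p.support,
      monomial d ((((n : ℂ) + 1) - d 0 - d 1) * coeff d p) := by
    unfold eul
    conv_lhs => rw [p.as_sum]
    simp only [map_sum, Finset.mul_sum]
    rw [← Finset.sum_sub_distrib, ← Finset.sum_sub_distrib]
    apply Finset.sum_congr rfl
    intro d _
    rw [X_mul_pderiv_monomial, X_mul_pderiv_monomial, C_mul_monomial]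
    simp only [← map_nsmul, ← map_sub]
    congr 1
    simp only [nsmul_eq_mul]
    ring
  rw [h]
  apply totalDegree_finsetSum_le
  intro d hd
  have h1 := (le_totalDegree hd).trans hp
  rw [degree_two] at h1
  by_cases h2 : d 0 + d 1 = n + 1
  · have : (((n : ℂ) + 1) - d 0 - d 1) = 0 := by
      have : ((d 0 : ℂ)) + d 1 = n + 1 := by exact_mod_cast h2
      linear_combination -this
    simp [this]
  · refine (totalDegree_monomial_le _ _).trans ?_
    have h3 := degree_two d
    have h4 : (d.sum fun _ e => e) ≤ n := by omega
    exact h4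

lemma td_mul {m n : ℕ} {p q : MvPolynomial (Fin 2) ℂ} (hp : p.totalDegree ≤ m)
    (hq : q.totalDegree ≤ n) : (p * q).totalDegree ≤ m + n :=
  (totalDegree_mul p q).trans (add_le_add hp hq)

lemma td_sub {m : ℕ} {p q : MvPolynomial (Fin 2) ℂ} (hp : p.totalDegree ≤ m)
    (hq : q.totalDegree ≤ m) : (p - q).totalDegree ≤ m :=
  (totalDegree_sub p q).trans (max_le hp hq)

lemma eval_cubic (a : MvPolynomial (Fin 2) ℂ) (ha : a.totalDegree ≤ 3) (u v : ℂ) :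
    eval ![u, v] a = ∑ m : Fin 10, u ^ e1 m * v ^ e2 m * coeff (mn (e1 m) (e2 m)) a := by
  let ι : ℕ × ℕ → (Fin 2 →₀ ℕ) := fun t => mn t.1 t.2
  have hι : Function.Injective ι := by
    rintro ⟨a, b⟩ ⟨a', b'⟩ h
    have h0 := DFunLike.congr_fun h 0
    have h1 := DFunLike.congr_fun h 1
    simp [ι, mn] at h0 h1
    simp [h0, h1]
  have h1 : eval ![u, v] a = ∑ d ∈ (Finset.range 4 ×ˢ Finset.range 4).image ι,
      coeff d a * ∏ k, (![u, v] k) ^ d k := by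
    rw [eval_eq']
    apply Finset.sum_subset
    · intro d hd
      have h1 := (le_totalDegree hd).trans ha
      rw [degree_two] at h1
      rw [Finset.mem_image]
      refine ⟨(d 0, d 1), by simp; omega, ?_⟩
      ext k
      fin_cases k <;> simp [ι, mn]
    · intro d _ hd
      rw [notMem_support_iff.1 hd, zero_mul]
  rw [h1, Finset.sum_image hι.injOn]
  have hz : ∀ m n : ℕ, 3 < m + n → coeff (mn m n) a = 0 := by
    intro m n hmn
    apply coeff_eq_zero_of_totalDegree_lt
    have := degree_two (mn m n)
    simp only [Finsupp.sum] at this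
    rw [this]
    simp [mn]; omega
  simp only [Finset.sum_product, Finset.sum_range_succ, Finset.sum_range_zero, Fin.sum_univ_succ,
    Fin.prod_univ_two, ι]
  simp [e1, e2, hz, mn, Fin.sum_univ_succ]
  simp [mn] at hz
  simp [hz]
  ring

lemma eval_g (u v : ℂ) : 308915776 * eval ![u, v] g = kG kW u v := by
  simp [g, g2, f2, h2, c, i, s, x, y, kG, kF, kH, kW]
  ring

lemma eval_gx (u v : ℂ) : 308915776 * eval ![u, v] (pderiv 0 g) = kGx kW u v := by
  simp [g, g2, f2, h2, c, i, s, x, y, kGx, kF, kH, kFx, kHx, kW, pderiv_mul, pderiv_pow, pderiv_X]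
  ring

lemma eval_gy (u v : ℂ) : 308915776 * eval ![u, v] (pderiv 1 g) = kGy kW u v := by
  simp [g, g2, f2, h2, c, i, s, x, y, kGy, kF, kH, kFy, kHy, kW, pderiv_mul, pderiv_pow, pderiv_X]
  ring

lemma eval_gz (u v : ℂ) : 308915776 * eval ![u, v] (eul 5 g) = kGz kW u v := by
  have h1 := eval_g u v
  have h2 := eval_gx u v
  have h3 := eval_gy u v
  simp only [eul, kGz, map_sub, map_mul, eval_C, eval_X]
  simp
  linear_combination 6 * h1 - u * h2 - v * h3

lemma key (A B D : MvPolynomial (Fin 2) ℂ) (hA : A.totalDegree ≤ 3) (hB : B.totalDegree ≤ 3)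
    (hD : D.totalDegree ≤ 3)
    (h : A * pderiv 0 g + B * pderiv 1 g + D * eul 5 g = 0) : A = 0 ∧ B = 0 ∧ D = 0 := by
  let z : Fin 30 → ℂ := fun j => coeff (mn (e1 (j % 10)) (e2 (j % 10)))
    (match j.val / 10 with
      | 0 => A
      | 1 => B
      | _ => D)
  have hz : z = 0 := by
    apply kM_inj
    ext r
    have h1 := congrArg (eval ![(uT r : ℂ), (vT r : ℂ)]) h
    simp only [map_add, map_mul, map_zero] at h1
    have hx := eval_gx (uT r) (vT r)
    have hy := eval_gy (uT r) (vT r)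
    have hh := eval_gz (uT r) (vT r)
    have h2 : eval ![(uT r : ℂ), (vT r : ℂ)] A * kGx kW (uT r) (vT r)
      + eval ![(uT r : ℂ), (vT r : ℂ)] B * kGy kW (uT r) (vT r)
      + eval ![(uT r : ℂ), (vT r : ℂ)] D * kGz kW (uT r) (vT r) = 0 := by
      rw [← hx, ← hy, ← hh]
      linear_combination 308915776 * h1
    rw [eval_cubic A hA, eval_cubic B hB, eval_cubic D hD] at h2
    simp only [Matrix.mulVec, dotProduct, Pi.zero_apply]
    rw [← h2]
    have hsplit : ∀ F : Fin 30 → ℂ, ∑ j, F j = ∑ m : Fin 10, F ⟨m.val, by omega⟩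
        + ∑ m : Fin 10, F ⟨10 + m.val, by omega⟩ + ∑ m : Fin 10, F ⟨20 + m.val, by omega⟩ := by
      intro F
      simp only [Fin.sum_univ_succ, Finset.univ_eq_empty, Finset.sum_empty]
      simp only [Fin.succ, Fin.val_zero]
      norm_num
      ring
    rw [hsplit, Finset.sum_mul, Finset.sum_mul, Finset.sum_mul]
    congr 1
    · congr 1
      · apply Finset.sum_congr rfl
        intro m _
        have q1 : m.val % 10 = m.val := by omega
        have q2 : m.val / 10 = 0 := by omega
        simp only [kM, z, q1, q2, kk]
        ring
      · apply Finset.sum_congr rfl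
        intro m _
        have q1 : (10 + m.val) % 10 = m.val := by omega
        have q2 : (10 + m.val) / 10 = 1 := by omega
        simp only [kM, z, q1, q2, kk]
        ring
    · apply Finset.sum_congr rfl
      intro m _
      have q1 : (20 + m.val) % 10 = m.val := by omega
      have q2 : (20 + m.val) / 10 = 2 := by omega
      simp only [kM, z, q1, q2, kk]
      ring
  have fin : ∀ E : MvPolynomial (Fin 2) ℂ, E.totalDegree ≤ 3 →
      (∀ m : Fin 10, coeff (mn (e1 m) (e2 m)) E = 0) → E = 0 := by
    intro E hE h0
    apply MvPolynomial.funext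
    intro t
    have ht : t = ![t 0, t 1] := by ext k; fin_cases k <;> rfl
    rw [ht, eval_cubic E hE]
    simp [h0]
  refine ⟨fin A hA ?_, fin B hB ?_, fin D hD ?_⟩
  · intro m
    have q := congrFun hz ⟨m.val, by omega⟩
    have q1 : m.val % 10 = m.val := by omega
    have q2 : m.val / 10 = 0 := by omega
    simpa only [z, q1, q2, Pi.zero_apply] using q
  · intro m
    have q := congrFun hz ⟨10 + m.val, by omega⟩
    have q1 : (10 + m.val) % 10 = m.val := by omega
    have q2 : (10 + m.val) / 10 = 1 := by omega
    simpa only [z, q1, q2, Pi.zero_apply] using q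
  · intro m
    have q := congrFun hz ⟨20 + m.val, by omega⟩
    have q1 : (20 + m.val) % 10 = m.val := by omega
    have q2 : (20 + m.val) / 10 = 2 := by omega
    simpa only [z, q1, q2, Pi.zero_apply] using q

lemma non_torus (p q : MvPolynomial (Fin 2) ℂ) (hp : p.totalDegree ≤ 2) (hq : q.totalDegree ≤ 3)
    (h : g = p ^ 3 + q ^ 2) : False := by
  have px := td_pderiv 0 1 p hp
  have py := td_pderiv 1 1 p hp
  have pz := td_eul 1 p hp
  have qx := td_pderiv 0 2 q hq
  have qy := td_pderiv 1 2 q hq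
  have qz := td_eul 2 q hq
  have gx : pderiv 0 g = 3 * p ^ 2 * pderiv 0 p + 2 * q * pderiv 0 q := by
    rw [h]; simp; ring
  have gy : pderiv 1 g = 3 * p ^ 2 * pderiv 1 p + 2 * q * pderiv 1 q := by
    rw [h]; simp; ring
  have gz : eul 5 g = 3 * p ^ 2 * eul 1 p + 2 * q * eul 2 q := by
    unfold eul
    rw [gx, gy, h]
    have e1 : (C (((5 : ℕ) : ℂ) + 1) : MvPolynomial (Fin 2) ℂ) = 6 := by
      rw [show (((5 : ℕ) : ℂ) + 1) = ((6 : ℕ) : ℂ) by norm_num, map_natCast]; rfl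
    have e2 : (C (((1 : ℕ) : ℂ) + 1) : MvPolynomial (Fin 2) ℂ) = 2 := by
      rw [show (((1 : ℕ) : ℂ) + 1) = ((2 : ℕ) : ℂ) by norm_num, map_natCast]; rfl
    have e3 : (C (((2 : ℕ) : ℂ) + 1) : MvPolynomial (Fin 2) ℂ) = 3 := by
      rw [show (((2 : ℕ) : ℂ) + 1) = ((3 : ℕ) : ℂ) by norm_num, map_natCast]; rfl
    rw [e1, e2, e3]
    ring
  obtain ⟨-, -, hc⟩ := key (pderiv 1 p * eul 2 q - eul 1 p * pderiv 1 q)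
    (eul 1 p * pderiv 0 q - pderiv 0 p * eul 2 q)
    (pderiv 0 p * pderiv 1 q - pderiv 1 p * pderiv 0 q)
    (td_sub (td_mul py qz) (td_mul pz qy)) (td_sub (td_mul pz qx) (td_mul px qz))
    (td_sub (td_mul px qy) (td_mul py qx)) (by rw [gx, gy, gz]; ring)
  have h0 : (0 : MvPolynomial (Fin 2) ℂ).totalDegree ≤ 3 := by simp
  obtain ⟨hpy, hpx, -⟩ := key (pderiv 1 p) (- pderiv 0 p) 0 (py.trans (by norm_num))
    (by rw [totalDegree_neg]; exact px.trans (by norm_num)) h0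
    (by rw [gx, gy]; linear_combination (-2 * q) * hc)
  obtain ⟨hqy, hqx, -⟩ := key (pderiv 1 q) (- pderiv 0 q) 0 (qy.trans (by norm_num))
    (by rw [totalDegree_neg]; exact qx.trans (by norm_num)) h0
    (by rw [gx, gy]; linear_combination (3 * p ^ 2) * hc)
  rw [neg_eq_zero] at hpx hqx
  obtain ⟨h1, -, -⟩ := key 1 0 0 (by simp) h0 h0 (by rw [gx, hpx, hqx]; ring)
  exact one_ne_zero h1

/-! ### Part 3: irreducibility -/

def res : MvPolynomial (Fin 2) ℂ →ₐ[ℂ] Polynomial ℂ := aeval ![Polynomial.X, 0]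

lemma eval_res (t : ℂ) (p : MvPolynomial (Fin 2) ℂ) : (res p).eval t = eval ![t, 0] p := by
  induction p using MvPolynomial.induction_on with
  | C r => simp [res]
  | add p q hp hq => simp [hp, hq]
  | mul_X p k hp =>
    rw [map_mul, Polynomial.eval_mul, hp, map_mul]
    fin_cases k <;> simp [res]

lemma natDegree_res (n : ℕ) (p : MvPolynomial (Fin 2) ℂ) (hp : p.totalDegree ≤ n) :
    (res p).natDegree ≤ n := by
  have := MvPolynomial.aeval_natDegree_le p hp ![(Polynomial.X : Polynomial ℂ), 0] (n := 1)
    (by intro k; fin_cases k <;> simp)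
  simpa [res] using this

section Branch
open Polynomial

lemma branch (A B A1 B1 A2 B2 U L S T : ℂ[X]) (t : ℂ) (h0 : A * B = U ^ 3)
    (h1 : A1 * B + A * B1 = 3 * U ^ 2 * L) (h2 : A2 * B + 2 * A1 * B1 + A * B2 = U * S + 2 * T)
    (hU : U.eval t = 0) (hU' : (derivative U).eval t ≠ 0) (hT : T.eval t ≠ 0)
    (hA : A.eval t = 0) (hB : B.eval t = 0) : False := by
  have k2 := congrArg (Polynomial.eval t) h2
  have k1 := congrArg (fun p => (derivative p).eval t) h1
  have d2 := congrArg (fun p => (derivative (derivative p)).eval t) h0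
  have d3 := congrArg (fun p => (derivative (derivative (derivative p))).eval t) h0
  simp [hA, hB, hU, derivative_pow] at k1
  simp [hA, hB, hU] at k2
  simp [hA, hB, hU, derivative_pow] at d2
  simp [hA, hB, hU, derivative_pow] at d3
  have e1 : eval t A1 ≠ 0 := by intro h; rw [h] at k2; simp at k2; exact hT k2
  have e2 : eval t B1 ≠ 0 := by intro h; rw [h] at k2; simp at k2; exact hT k2
  have e3 : eval t (derivative A) * eval t (derivative B) = 0 := by
    rcases d2 with h | h <;> simp [h]
  have e4 : eval t (derivative A) = 0 ∧ eval t (derivative B) = 0 := by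
    rcases mul_eq_zero.1 e3 with h | h
    · rw [h] at k1; simp [e1] at k1; exact ⟨h, k1⟩
    · rw [h] at k1; simp [e2] at k1; exact ⟨k1, h⟩
  rw [e4.1, e4.2] at d3
  simp [hU'] at d3

lemma core (A1 B1 A2 B2 R1 R2 : Polynomial ℂ) (α β k3 n0 n1 n2 : ℂ) (hαβ : α * β = 1)
    (hA1 : A1.natDegree ≤ 2) (hA2 : A2.natDegree ≤ 1)
    (h1 : A1 * ((1 - Polynomial.X) ^ 3 * Polynomial.C β) + Polynomial.X ^ 3 * Polynomial.C α * B1 = Polynomial.C 3 * Polynomial.X ^ 2 + Polynomial.C k3 * Polynomial.X ^ 3 + Polynomial.X ^ 4 * R1)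
    (h2 : A2 * ((1 - Polynomial.X) ^ 3 * Polynomial.C β) + 2 * A1 * B1 + Polynomial.X ^ 3 * Polynomial.C α * B2
      = Polynomial.C n0 + Polynomial.C n1 * Polynomial.X + Polynomial.C n2 * Polynomial.X ^ 2 + Polynomial.X ^ 3 * R2) :
    n2 + 3 * n1 + 6 * n0 - 6 * k3 - 54 = 0 := by
  have hA13 : A1.coeff 3 = 0 := Polynomial.coeff_eq_zero_of_natDegree_lt (by omega)
  have hA22 : A2.coeff 2 = 0 := Polynomial.coeff_eq_zero_of_natDegree_lt (by omega)
  have h1' : Polynomial.C β * A1 - Polynomial.C (3 * β) * (A1 * Polynomial.X ^ 1) + Polynomial.C (3 * β) * (A1 * Polynomial.X ^ 2) - Polynomial.C β * (A1 * Polynomial.X ^ 3)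
      + Polynomial.C α * (B1 * Polynomial.X ^ 3) = Polynomial.C 3 * Polynomial.X ^ 2 + Polynomial.C k3 * Polynomial.X ^ 3 + R1 * Polynomial.X ^ 4 := by
    simp only [map_mul]
    rw [show (Polynomial.C 3 : Polynomial ℂ) = 3 from rfl] at *
    linear_combination h1
  have h2' : Polynomial.C β * A2 - Polynomial.C (3 * β) * (A2 * Polynomial.X ^ 1) + Polynomial.C (3 * β) * (A2 * Polynomial.X ^ 2) - Polynomial.C β * (A2 * Polynomial.X ^ 3)
      + Polynomial.C 2 * (A1 * B1) + Polynomial.C α * (B2 * Polynomial.X ^ 3)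
      = Polynomial.C n0 + Polynomial.C n1 * Polynomial.X ^ 1 + Polynomial.C n2 * Polynomial.X ^ 2 + R2 * Polynomial.X ^ 3 := by
    simp only [map_mul]
    rw [show (Polynomial.C 3 : Polynomial ℂ) = 3 from rfl, show (Polynomial.C 2 : Polynomial ℂ) = 2 from rfl]
    linear_combination h2
  have c0 := congrArg (fun p => p.coeff 0) h1'
  have c1 := congrArg (fun p => p.coeff 1) h1'
  have c2 := congrArg (fun p => p.coeff 2) h1'
  have c3 := congrArg (fun p => p.coeff 3) h1'
  have d0 := congrArg (fun p => p.coeff 0) h2'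
  have d1 := congrArg (fun p => p.coeff 1) h2'
  have d2 := congrArg (fun p => p.coeff 2) h2'
  simp only [Polynomial.coeff_add, Polynomial.coeff_sub, Polynomial.coeff_C_mul, Polynomial.coeff_mul_X_pow', Polynomial.coeff_X_pow, Polynomial.coeff_C, hA13, hA22,
    Polynomial.coeff_mul A1 B1, Finset.Nat.sum_antidiagonal_eq_sum_range_succ (fun k l => A1.coeff k * B1.coeff l),
    Finset.sum_range_succ, Finset.sum_range_zero] at c0 c1 c2 c3 d0 d1 d2
  norm_num at c0 c1 c2 c3 d0 d1 d2
  have hβ : β ≠ 0 := by rintro rfl; simp at hαβ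
  have z0 : A1.coeff 0 = 0 := by simpa [hβ] using c0
  rw [z0] at c1 c2 c3 d0 d1 d2
  have z1 : A1.coeff 1 = 0 := by simpa [hβ] using c1
  rw [z1] at c2 c3 d1 d2
  have e2 : β * A1.coeff 2 = 3 := by linear_combination c2
  have e3 : α * B1.coeff 0 = k3 + 9 := by linear_combination c3 + 3 * e2
  have e4 : A1.coeff 2 * B1.coeff 0 = 3 * (k3 + 9) := by
    linear_combination (α * B1.coeff 0) * e2 + 3 * e3 - (A1.coeff 2 * B1.coeff 0) * hαβ
  linear_combination -d2 - 3 * d1 - 6 * d0 + 2 * e4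

end Branch

def kb : ℂ := -53 / 26 + 15 / 26 * kW
def km : ℂ := -667 / 676 - 135 / 676 * kW
def q0 : ℂ := -25029 / 57122 + 16605 / 28561 * kW
def q1 : ℂ := -373005 / 228488 - 291195 / 228488 * kW
def q2 : ℂ := 409455 / 228488 + 18225 / 228488 * kW

lemma kW_comb (r t : ℝ) (ht : t ≠ 0) : (r : ℂ) + (t : ℂ) * kW ≠ 0 := by
  intro h
  have := congrArg Complex.im h
  simp [kW, ht] at this

def rU : Polynomial ℂ := Polynomial.X - Polynomial.X ^ 2
def rL : Polynomial ℂ := 1 + Polynomial.C kb * Polynomial.X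
def rS : Polynomial ℂ := 6 * rL ^ 2 + 6 * rU * Polynomial.C km
def rT : Polynomial ℂ :=
  Polynomial.C q0 + Polynomial.C q1 * Polynomial.X + Polynomial.C q2 * Polynomial.X ^ 2

lemma res0 : res g = rU ^ 3 := by
  apply Polynomial.funext
  intro t
  rw [eval_res]
  simp [g, g2, f2, h2, c, i, s, x, y, rU]
  ring

lemma res1 : res (pderiv 1 g) = 3 * rU ^ 2 * rL := by
  apply Polynomial.funext
  intro t
  rw [eval_res]
  simp [g, g2, f2, h2, c, i, s, x, y, rU, rL, kb, kW, pderiv_X]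
  ring

lemma res2 : res (pderiv 1 (pderiv 1 g)) = rU * rS + 2 * rT := by
  have h3 : pderiv (1 : Fin 2) (3 : MvPolynomial (Fin 2) ℂ) = 0 := by
    rw [show (3 : MvPolynomial (Fin 2) ℂ) = C 3 from rfl]; exact pderiv_C
  apply Polynomial.funext
  intro t
  rw [eval_res]
  simp [g, g2, f2, h2, c, i, s, x, y, rU, rL, rS, rT, kb, km, q0, q1, q2, kW, pderiv_X, h3]
  ring

lemma td_add {m : ℕ} {p q : MvPolynomial (Fin 2) ℂ} (hp : p.totalDegree ≤ m)
    (hq : q.totalDegree ≤ m) : (p + q).totalDegree ≤ m :=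
  (totalDegree_add p q).trans (max_le hp hq)
lemma td_neg {m : ℕ} {p : MvPolynomial (Fin 2) ℂ} (hp : p.totalDegree ≤ m) :
    (-p).totalDegree ≤ m := by rwa [totalDegree_neg]
lemma td_c (q : ℚ) (m : ℕ) : (c q).totalDegree ≤ m := by simp [c]
lemma td_i {m : ℕ} {p : MvPolynomial (Fin 2) ℂ} (hp : p.totalDegree ≤ m) :
    (p * i).totalDegree ≤ m := td_mul hp (by simp [i] : i.totalDegree ≤ 0)
lemma td_s {m : ℕ} {p : MvPolynomial (Fin 2) ℂ} (hp : p.totalDegree ≤ m) :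
    (p * s).totalDegree ≤ m := td_mul hp (by simp [s] : s.totalDegree ≤ 0)
lemma td_x (m : ℕ) : x.totalDegree ≤ m + 1 := by simp [x]
lemma td_y (m : ℕ) : y.totalDegree ≤ m + 1 := by simp [y]
lemma td_x2 (m : ℕ) : (x ^ 2).totalDegree ≤ m + 2 := by simp [x]
lemma td_y2 (m : ℕ) : (y ^ 2).totalDegree ≤ m + 2 := by simp [y]
lemma td_mx {m : ℕ} {p : MvPolynomial (Fin 2) ℂ} (hp : p.totalDegree ≤ m) :
    (p * x).totalDegree ≤ m + 1 := td_mul hp (td_x 0)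
lemma td_my {m : ℕ} {p : MvPolynomial (Fin 2) ℂ} (hp : p.totalDegree ≤ m) :
    (p * y).totalDegree ≤ m + 1 := td_mul hp (td_y 0)
lemma td_mx2 {m : ℕ} {p : MvPolynomial (Fin 2) ℂ} (hp : p.totalDegree ≤ m) :
    (p * x ^ 2).totalDegree ≤ m + 2 := td_mul hp (td_x2 0)
lemma td_my2 {m : ℕ} {p : MvPolynomial (Fin 2) ℂ} (hp : p.totalDegree ≤ m) :
    (p * y ^ 2).totalDegree ≤ m + 2 := td_mul hp (td_y2 0)

lemma td_f2 : f2.totalDegree ≤ 2 := by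
  unfold f2
  repeat' first
    | with_reducible apply td_add | with_reducible apply td_sub | with_reducible apply td_i | with_reducible apply td_s | with_reducible apply td_mx2 | with_reducible apply td_my2
    | with_reducible apply td_mx | with_reducible apply td_my | with_reducible apply td_c | with_reducible apply td_x | with_reducible apply td_y | with_reducible apply td_x2 | with_reducible apply td_y2
    | with_reducible apply td_neg

lemma td_h2 : h2.totalDegree ≤ 2 := by
  unfold h2
  repeat' first
    | with_reducible apply td_add | with_reducible apply td_sub | with_reducible apply td_i | with_reducible apply td_s | with_reducible apply td_mx2 | with_reducible apply td_my2
    | with_reducible apply td_mx | with_reducible apply td_my | with_reducible apply td_c | with_reducible apply td_x | with_reducible apply td_y | with_reducible apply td_x2 | with_reducible apply td_y2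
    | with_reducible apply td_neg

lemma td_g : g.totalDegree ≤ 6 := by
  unfold g g2
  apply td_add
  · exact (totalDegree_pow _ _).trans (by have := td_f2; omega)
  · exact (td_mul (td_y2 0) td_h2).trans (by norm_num)

lemma g_ne : g ≠ 0 := by
  intro h
  have := res0
  rw [h, map_zero] at this
  have := congrArg (Polynomial.eval 2) this
  simp [rU] at this
  norm_num at this

lemma half (a b : MvPolynomial (Fin 2) ℂ) (hab : g = a * b) (ha0 : (res a).eval 0 = 0) :
    IsUnit b := by
  have hne := g_ne
  rw [hab] at hne
  have ha := left_ne_zero_of_mul hne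
  have hb := right_ne_zero_of_mul hne
  have htd : a.totalDegree + b.totalDegree ≤ 6 := by
    rw [← totalDegree_mul_of_isDomain ha hb, ← hab]; exact td_g
  have h0 : res a * res b = rU ^ 3 := by rw [← map_mul, ← hab, res0]
  have h1 : res (pderiv 1 a) * res b + res a * res (pderiv 1 b) = 3 * rU ^ 2 * rL := by
    rw [← res1, hab, pderiv_mul]; simp
  have h2 : res (pderiv 1 (pderiv 1 a)) * res b + 2 * res (pderiv 1 a) * res (pderiv 1 b)
      + res a * res (pderiv 1 (pderiv 1 b)) = rU * rS + 2 * rT := by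
    rw [← res2, hab]; simp only [pderiv_mul, map_add, map_mul]; ring
  have hU : rU ≠ 0 := by
    intro h
    have := congrArg (Polynomial.eval 2) h
    simp [rU] at this
    norm_num at this
  have hA : res a ≠ 0 := by intro h; rw [h, zero_mul] at h0; exact pow_ne_zero 3 hU h0.symm
  have hB : res b ≠ 0 := by intro h; rw [h, mul_zero] at h0; exact pow_ne_zero 3 hU h0.symm
  have hb0 : (res b).eval 0 ≠ 0 := by
    intro hb0
    refine branch _ _ _ _ _ _ _ _ _ _ 0 h0 h1 h2 (by simp [rU]) (by simp [rU]) ?_ ha0 hb0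
    have := kW_comb (-25029 / 57122) (16605 / 28561) (by norm_num)
    simpa [rT, q0] using this
  have h1ab : ¬ ((res a).eval 1 = 0 ∧ (res b).eval 1 = 0) := by
    rintro ⟨ha1, hb1⟩
    refine branch _ _ _ _ _ _ _ _ _ _ 1 h0 h1 h2 (by simp [rU]) ?_ ?_ ha1 hb1
    · simp [rU]
    · have := kW_comb (-63666 / 228488) (-140130 / 228488) (by norm_num)
      intro h
      apply this
      rw [← h]
      simp [rT, q0, q1, q2]
      ring
  have hfac : rU ^ 3 = Polynomial.X ^ 3 * (-(Polynomial.X - Polynomial.C 1) ^ 3) := by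
    simp [rU]; ring
  have hX : Polynomial.X ^ 3 ∣ res a := by
    apply Polynomial.prime_X.pow_dvd_of_dvd_mul_right 3 (b := res b)
    · rw [Polynomial.X_dvd_iff, Polynomial.coeff_zero_eq_eval_zero]; exact hb0
    · rw [h0, hfac]; exact Dvd.intro _ rfl
  have hdeg3 : ∀ t : ℂ, ((Polynomial.X - Polynomial.C t) ^ 3).natDegree = 3 := by
    intro t; simp
  have hda := natDegree_res _ a le_rfl
  have hdb := natDegree_res _ b le_rfl
  have hd1 : (Polynomial.X - Polynomial.C (1 : ℂ)) ^ 3 ∣ res a * res b := by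
    rw [h0, hfac]; exact ⟨-Polynomial.X ^ 3, by ring⟩
  by_cases hb1 : (res b).eval 1 = 0
  · exfalso
    have ha1 : (res a).eval 1 ≠ 0 := fun h => h1ab ⟨h, hb1⟩
    have hY : (Polynomial.X - Polynomial.C (1 : ℂ)) ^ 3 ∣ res b := by
      apply (Polynomial.prime_X_sub_C (1 : ℂ)).pow_dvd_of_dvd_mul_left 3 (a := res a) _ hd1
      rw [Polynomial.dvd_iff_isRoot]; exact ha1
    have n1 := Polynomial.natDegree_le_of_dvd hX hA
    have n2 := Polynomial.natDegree_le_of_dvd hY hB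
    rw [hdeg3] at n2
    rw [Polynomial.natDegree_X_pow] at n1
    obtain ⟨A', hA'⟩ := hX
    obtain ⟨B', hB'⟩ := hY
    have m1 : A'.natDegree = 0 := by
      have hA'0 : A' ≠ 0 := by rintro rfl; simp at hA'; exact hA hA'
      have := Polynomial.natDegree_mul (pow_ne_zero 3 Polynomial.X_ne_zero) hA'0
      rw [← hA', Polynomial.natDegree_X_pow] at this
      omega
    have m2 : B'.natDegree = 0 := by
      have hB'0 : B' ≠ 0 := by rintro rfl; simp at hB'; exact hB hB'
      have := Polynomial.natDegree_mul (pow_ne_zero 3 (Polynomial.X_sub_C_ne_zero (1 : ℂ))) hB'0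
      rw [← hB', hdeg3] at this
      omega
    obtain ⟨α, rfl⟩ := Polynomial.natDegree_eq_zero.1 m1
    obtain ⟨β, rfl⟩ := Polynomial.natDegree_eq_zero.1 m2
    have hαβ : α * (-β) = 1 := by
      have := congrArg (Polynomial.eval 2) h0
      rw [hA', hB'] at this
      simp [rU] at this
      linear_combination (-1 / 8) * this
    have hB'' : res b = (1 - Polynomial.X) ^ 3 * Polynomial.C (-β) := by
      rw [hB']; simp; ring
    have ta : (pderiv 1 a).totalDegree ≤ 2 := td_pderiv 1 2 a (by omega)
    have ta' : (pderiv 1 (pderiv 1 a)).totalDegree ≤ 1 := td_pderiv 1 1 _ ta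
    rw [hA', hB''] at h1 h2
    have hc := core _ _ _ _ (Polynomial.C (3 - 6 * kb) + Polynomial.C (3 * kb) * Polynomial.X)
      (Polynomial.C (6 * kb ^ 2 - 12 * kb - 12 * km)
        + Polynomial.C (6 * km - 6 * kb ^ 2) * Polynomial.X) α (-β) (3 * kb - 6) (2 * q0) (6 + 2 * q1)
      (12 * kb - 6 + 6 * km + 2 * q2) hαβ
      (natDegree_res _ _ ta) (natDegree_res _ _ ta')
      (by
        rw [h1]
        apply Polynomial.funext
        intro t
        simp [rU, rL]
        ring)
      (by
        rw [h2]
        apply Polynomial.funext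
        intro t
        simp [rU, rL, rS, rT]
        ring)
    refine kW_comb (-637383 / 57122) (-295335 / 57122) (by norm_num) ?_
    rw [← hc]
    simp only [kb, km, q0, q1, q2]
    push_cast
    ring
  · have hY : (Polynomial.X - Polynomial.C (1 : ℂ)) ^ 3 ∣ res a := by
      apply (Polynomial.prime_X_sub_C (1 : ℂ)).pow_dvd_of_dvd_mul_right 3 (b := res b) _ hd1
      rw [Polynomial.dvd_iff_isRoot]; exact hb1
    have hcop : IsCoprime ((Polynomial.X : Polynomial ℂ) ^ 3)
        ((Polynomial.X - Polynomial.C (1 : ℂ)) ^ 3) := by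
      apply IsCoprime.pow
      exact ⟨1, -1, by simp⟩
    have n1 := Polynomial.natDegree_le_of_dvd (hcop.mul_dvd hX hY) hA
    rw [Polynomial.natDegree_mul (pow_ne_zero 3 Polynomial.X_ne_zero)
      (pow_ne_zero 3 (Polynomial.X_sub_C_ne_zero (1 : ℂ))), hdeg3, Polynomial.natDegree_X_pow] at n1
    have hb3 : b.totalDegree = 0 := by omega
    rw [totalDegree_eq_zero_iff_eq_C] at hb3
    rw [hb3] at hb ⊢
    apply IsUnit.map
    rw [isUnit_iff_ne_zero]
    intro h
    rw [h] at hb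
    simp at hb

/-- `g` is irreducible and of non-torus type. -/
theorem g_irreducible_and_non_torus :
    Irreducible g ∧
      ¬ ∃ p q : MvPolynomial (Fin 2) ℂ,
        p.totalDegree ≤ 2 ∧ q.totalDegree ≤ 3 ∧ g = p ^ 3 + q ^ 2 := by
  have hev : (res g).eval 0 = 0 := by rw [res0]; simp [rU]
  refine ⟨⟨?_, ?_⟩, ?_⟩
  · intro h
    have h1 := (h.map res).map (Polynomial.evalRingHom (0 : ℂ))
    rw [Polynomial.coe_evalRingHom, hev] at h1
    simp at h1
  · intro a b hab
    rw [hab, map_mul, Polynomial.eval_mul] at hev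
    rcases mul_eq_zero.1 hev with h | h
    · exact Or.inr (half a b hab h)
    · exact Or.inl (half b a (by rw [hab, mul_comm]) h)
  · rintro ⟨p, q, hp, hq, h⟩
    exact non_torus p q hp hq h

end
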